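/- Deterministic core of Theorem 1: under DCDFM, let A be any real symmetric n×n matrix, let Û ∈ ℝ^{n×K} have orthonormal columns and all rows nonzero with row-normalized version Û_*, and suppose 𝒪 ∈ ℝ^{K×K} is an orthogonal matrix satisfying ‖Û𝒪 − U‖_F ≤ 2√(2K) ‖A − Ω‖ / σ_K(Ω), where σ_K(Ω) is the K-th largest singular value of Ω. Then ‖Û_*𝒪 − U_*‖_F ≤ 4 θ_max √(2 K n_max) ‖A − Ω‖ / (|λ_K(P)| θ_min³ n_min), where λ_K(P) is the smallest-in-magnitude eigenvalue of P. -/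

import Mathlib

open Matrix

/-- The spectral norm (ℓ²-operator norm) of a real square matrix. -/
noncomputable def specNorm {n : ℕ} (M : Matrix (Fin n) (Fin n) ℝ) : ℝ :=
  ‖Matrix.toEuclideanCLM (𝕜 := ℝ) M‖

/-- The Euclidean norm of a row vector in `ℝ^K`. -/
noncomputable def rowNorm {K : ℕ} (v : Fin K → ℝ) : ℝ :=
  Real.sqrt (∑ k, v k ^ 2)

/-- The Frobenius norm of an `n × K` real matrix. -/
noncomputable def frobNorm {n K : ℕ} (M : Matrix (Fin n) (Fin K) ℝ) : ℝ :=
  Real.sqrt (∑ i, ∑ k, M i k ^ 2)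

theorem rowNorm_eq_norm_toLp {K : ℕ} (v : Fin K → ℝ) : rowNorm v = ‖WithLp.toLp 2 v‖ := by
  simp [rowNorm, EuclideanSpace.norm_eq]

theorem rowNorm_sq {K : ℕ} (v : Fin K → ℝ) : rowNorm v ^ 2 = v ⬝ᵥ v := by
  rw [rowNorm, Real.sq_sqrt (Finset.sum_nonneg fun k _ => sq_nonneg (v k))]
  simp [dotProduct, sq]

theorem rowNorm_nonneg {K : ℕ} (v : Fin K → ℝ) : 0 ≤ rowNorm v := Real.sqrt_nonneg _

theorem rowNorm_pos {K : ℕ} {v : Fin K → ℝ} (hv : v ≠ 0) : 0 < rowNorm v := by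
  rw [rowNorm_eq_norm_toLp, norm_pos_iff]
  simpa using hv

theorem rowNorm_vecMul_of_orthogonal {K : ℕ} {O : Matrix (Fin K) (Fin K) ℝ} (hO : Oᵀ * O = 1)
    (v : Fin K → ℝ) : rowNorm (v ᵥ* O) = rowNorm v := by
  rw [← sq_eq_sq₀ (rowNorm_nonneg _) (rowNorm_nonneg _), rowNorm_sq, rowNorm_sq,
    ← dotProduct_mulVec, ← vecMul_transpose, vecMul_vecMul, mul_eq_one_comm.mp hO, vecMul_one]

/-- Normalizing two nonzero vectors amplifies their distance by at most `2 / ‖b‖`. -/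
theorem norm_normalize_sub_le {E : Type*} [NormedAddCommGroup E] [NormedSpace ℝ E] {a b : E}
    (ha : a ≠ 0) (hb : b ≠ 0) : ‖‖a‖⁻¹ • a - ‖b‖⁻¹ • b‖ ≤ 2 / ‖b‖ * ‖a - b‖ := by
  have ha' : 0 < ‖a‖ := norm_pos_iff.mpr ha
  have hb' : 0 < ‖b‖ := norm_pos_iff.mpr hb
  have key : ‖a‖⁻¹ • a - ‖b‖⁻¹ • b = ‖b‖⁻¹ • (((‖b‖ - ‖a‖) * ‖a‖⁻¹) • a + (a - b)) := by
    rw [smul_add, smul_sub, smul_smul, ← add_sub_assoc, ← add_smul]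
    congr 2
    field_simp
    ring
  rw [key, norm_smul, norm_inv, norm_norm]
  have h1 : ‖((‖b‖ - ‖a‖) * ‖a‖⁻¹) • a‖ ≤ ‖a - b‖ := by
    rw [norm_smul, norm_mul, norm_inv, norm_norm, mul_assoc, inv_mul_cancel₀ ha'.ne', mul_one,
      norm_sub_rev a b]
    exact abs_norm_sub_norm_le b a
  calc ‖b‖⁻¹ * ‖((‖b‖ - ‖a‖) * ‖a‖⁻¹) • a + (a - b)‖
      ≤ ‖b‖⁻¹ * (‖a - b‖ + ‖a - b‖) := by
        gcongr
        exact (norm_add_le _ _).trans (by gcongr)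
    _ = 2 / ‖b‖ * ‖a - b‖ := by ring

theorem rowNorm_normalize_sub_le {K : ℕ} {a b : Fin K → ℝ} (ha : a ≠ 0) (hb : b ≠ 0) :
    rowNorm ((rowNorm a)⁻¹ • a - (rowNorm b)⁻¹ • b) ≤ 2 / rowNorm b * rowNorm (a - b) := by
  simp only [rowNorm_eq_norm_toLp]
  exact norm_normalize_sub_le (a := WithLp.toLp 2 a) (b := WithLp.toLp 2 b)
    (by simpa using ha) (by simpa using hb)

theorem frobNorm_le_mul_of_rowNorm_le {n K : ℕ} {M N : Matrix (Fin n) (Fin K) ℝ} {c : ℝ}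
    (hc : 0 ≤ c) (h : ∀ i, rowNorm (M i) ≤ c * rowNorm (N i)) :
    frobNorm M ≤ c * frobNorm N := by
  have hfrob : ∀ L : Matrix (Fin n) (Fin K) ℝ, frobNorm L = √(∑ i, rowNorm (L i) ^ 2) := by
    intro L
    simp only [frobNorm, rowNorm_sq, dotProduct, ← sq]
  rw [hfrob, hfrob, ← Real.sqrt_sq hc, ← Real.sqrt_mul (sq_nonneg c), Finset.mul_sum]
  refine Real.sqrt_le_sqrt (Finset.sum_le_sum fun i _ => ?_)
  rw [← mul_pow]
  exact pow_le_pow_left₀ (rowNorm_nonneg _) (h i) 2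

/-- A symmetric matrix expands every vector by at least its least absolute eigenvalue. -/
theorem mul_rowNorm_le_rowNorm_mulVec {K : ℕ} {P : Matrix (Fin K) (Fin K) ℝ}
    (hP : P.IsHermitian) {c : ℝ} (hc : 0 ≤ c) (h : ∀ k, c ≤ |hP.eigenvalues k|)
    (y : Fin K → ℝ) : c * rowNorm y ≤ rowNorm (P *ᵥ y) := by
  refine (abs_le_of_sq_le_sq' ?_ (rowNorm_nonneg _)).2
  have hinner : ∀ k, inner ℝ (hP.eigenvectorBasis k) (WithLp.toLp 2 (P *ᵥ y))
      = hP.eigenvalues k * inner ℝ (hP.eigenvectorBasis k) (WithLp.toLp 2 y) := by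
    intro k
    have hsymm : Pᵀ = P := by simpa [IsSymm] using hP
    have := hP.mulVec_eigenvectorBasis k
    simp only [EuclideanSpace.inner_eq_star_dotProduct, star_trivial]
    rw [dotProduct_comm, dotProduct_mulVec, ← mulVec_transpose, hsymm, this, smul_dotProduct,
      smul_eq_mul, dotProduct_comm]
  rw [mul_pow, rowNorm_eq_norm_toLp, rowNorm_eq_norm_toLp,
    ← hP.eigenvectorBasis.sum_sq_norm_inner_right, ← hP.eigenvectorBasis.sum_sq_norm_inner_right,
    Finset.mul_sum]
  refine Finset.sum_le_sum fun k _ => ?_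
  rw [hinner, norm_mul, mul_pow]
  gcongr
  exact h k

/-- If `D` has orthogonal columns with squared lengths `w k ≥ c`, then every nonzero eigenvalue of
`D * P * Dᵀ` is at least `lam * c` in absolute value, where `lam` bounds the absolute eigenvalues
of `P` from below. -/
theorem mul_le_abs_of_mulVec_eq_smul {n K : ℕ} {D : Matrix (Fin n) (Fin K) ℝ} {w : Fin K → ℝ}
    (hD : Dᵀ * D = diagonal w) {c : ℝ} (hc : 0 ≤ c) (hw : ∀ k, c ≤ w k)
    {P : Matrix (Fin K) (Fin K) ℝ} (hP : P.IsHermitian) {lam : ℝ} (hlam : 0 ≤ lam)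
    (h : ∀ k, lam ≤ |hP.eigenvalues k|) {v : Fin n → ℝ} (hv : v ≠ 0) {μ : ℝ} (hμ : μ ≠ 0)
    (hvμ : (D * P * Dᵀ) *ᵥ v = μ • v) : lam * c ≤ |μ| := by
  set x := Dᵀ *ᵥ v with hx
  have hDPx : D *ᵥ (P *ᵥ x) = μ • v := by
    rw [← hvμ, hx, mulVec_mulVec, mulVec_mulVec]
  have hx0 : x ≠ 0 := by
    intro h0
    rw [h0, mulVec_zero, mulVec_zero] at hDPx
    exact (smul_ne_zero hμ hv) hDPx.symm
  have hWx : diagonal w *ᵥ (P *ᵥ x) = μ • x := by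
    rw [← hD, ← mulVec_mulVec, hDPx, mulVec_smul]
  have hdiag : c * rowNorm (P *ᵥ x) ≤ rowNorm (diagonal w *ᵥ (P *ᵥ x)) := by
    refine (abs_le_of_sq_le_sq' ?_ (rowNorm_nonneg _)).2
    rw [mul_pow, rowNorm_sq, rowNorm_sq, dotProduct, dotProduct, Finset.mul_sum]
    refine Finset.sum_le_sum fun k _ => ?_
    rw [mulVec_diagonal]
    have := pow_le_pow_left₀ hc (hw k) 2
    nlinarith [mul_self_nonneg ((P *ᵥ x) k)]
  have hsmul : rowNorm (μ • x) = |μ| * rowNorm x := by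
    simp [rowNorm_eq_norm_toLp, norm_smul]
  refine le_of_mul_le_mul_right ?_ (rowNorm_pos hx0)
  calc lam * c * rowNorm x = c * (lam * rowNorm x) := by ring
    _ ≤ c * rowNorm (P *ᵥ x) := by
        gcongr
        exact mul_rowNorm_le_rowNorm_mulVec hP hlam h x
    _ ≤ |μ| * rowNorm x := by rw [← hsmul, ← hWx]; exact hdiag

/-- If `D * B` has orthonormal columns and `D` has orthogonal columns with squared lengths `w`, then
the `k`-th row of the square matrix `B` has squared length `1 / w k`. -/
theorem rowNorm_sq_mul_eq_one {n K : ℕ} {D : Matrix (Fin n) (Fin K) ℝ} {w : Fin K → ℝ}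
    (hD : Dᵀ * D = diagonal w) {B : Matrix (Fin K) (Fin K) ℝ}
    (hB : (D * B)ᵀ * (D * B) = 1) (k : Fin K) : rowNorm (B k) ^ 2 * w k = 1 := by
  have h1 : Bᵀ * diagonal w * B = 1 := by
    rw [← hB, ← hD, transpose_mul]
    simp only [Matrix.mul_assoc]
  have h2 : (B * (Bᵀ * diagonal w)) k k = (1 : Matrix (Fin K) (Fin K) ℝ) k k := by
    rw [mul_eq_one_comm.mp h1]
  rw [← Matrix.mul_assoc, mul_diagonal, one_apply_eq] at h2
  rw [rowNorm_sq]
  exact h2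

/-- **Deterministic core of Theorem 1 (paper).** Under DCDFM, let `A` be a real symmetric
`n × n` matrix, `Û ∈ ℝ^{n×K}` have orthonormal columns and nonzero rows, and let `𝒪` be a
`K × K` orthogonal matrix with `‖Û𝒪 − U‖_F ≤ 2√(2K) ‖A − Ω‖ / σ_K(Ω)`, where `σ_K(Ω)` is
the `K`-th largest singular value of `Ω` (the smallest nonzero one, since `Ω` is symmetric
of rank `K`, i.e. the smallest nonzero `|eigenvalue|` of `Ω`).  Then
`‖Û_*𝒪 − U_*‖_F ≤ 4 θ_max √(2 K n_max) ‖A − Ω‖ / (|λ_K(P)| θ_min³ n_min)`,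
where `λ_K(P)` is the smallest-in-magnitude eigenvalue of `P`. -/
theorem dcdfm_rowNormalized_eigenvector_perturbation
    (n K : ℕ) [NeZero n] [NeZero K] (hKn : K ≤ n)
    (ℓ : Fin n → Fin K) (hℓ : Function.Surjective ℓ)
    (Z : Matrix (Fin n) (Fin K) ℝ)
    (hZ : ∀ i k, Z i k = if ℓ i = k then 1 else 0)
    (P : Matrix (Fin K) (Fin K) ℝ)
    (hPsymm : P.IsSymm) (hPrank : P.rank = K)
    (hPle : ∀ k l, |P k l| ≤ 1) (hPeq : ∃ k l, |P k l| = 1)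
    (θ : Fin n → ℝ) (hθ : ∀ i, 0 < θ i)
    (Om : Matrix (Fin n) (Fin n) ℝ)
    (hOm : Om = Matrix.diagonal θ * Z * P * Zᵀ * Matrix.diagonal θ)
    (U : Matrix (Fin n) (Fin K) ℝ)
    (Λ : Matrix (Fin K) (Fin K) ℝ) (d : Fin K → ℝ)
    (hΛ : Λ = Matrix.diagonal d) (hd : ∀ k, d k ≠ 0)
    (hUU : Uᵀ * U = 1)
    (hdec : Om = U * Λ * Uᵀ)
    (hUrow : ∀ i, U i ≠ 0)
    (θmin θmax : ℝ)
    (hθmin : θmin = Finset.univ.inf' Finset.univ_nonempty θ)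
    (hθmax : θmax = Finset.univ.sup' Finset.univ_nonempty θ)
    (nmin nmax : ℕ)
    (hnmin : nmin = Finset.univ.inf' Finset.univ_nonempty
        fun k => (Finset.univ.filter fun i => ℓ i = k).card)
    (hnmax : nmax = Finset.univ.sup' Finset.univ_nonempty
        fun k => (Finset.univ.filter fun i => ℓ i = k).card)
    (hPH : P.IsHermitian)
    (lamKP : ℝ)
    (hlamKP : lamKP = Finset.univ.inf' Finset.univ_nonempty
        fun k => |hPH.eigenvalues k|)
    (hOmH : Om.IsHermitian)
    (sK : ℝ)
    (hsK : sK = sInf {x : ℝ | ∃ i, hOmH.eigenvalues i ≠ 0 ∧ x = |hOmH.eigenvalues i|})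
    (A : Matrix (Fin n) (Fin n) ℝ) (hA : A.IsSymm)
    (Uh : Matrix (Fin n) (Fin K) ℝ)
    (hUh : Uhᵀ * Uh = 1) (hUhrow : ∀ i, Uh i ≠ 0)
    (O : Matrix (Fin K) (Fin K) ℝ) (hO : Oᵀ * O = 1)
    (hbound : frobNorm (Uh * O - U)
        ≤ 2 * Real.sqrt (2 * K) * specNorm (A - Om) / sK) :
    frobNorm ((Matrix.of fun i k => Uh i k / rowNorm (Uh i)) * O
          - Matrix.of fun i k => U i k / rowNorm (U i))
      ≤ 4 * θmax * Real.sqrt (2 * K * nmax) * specNorm (A - Om)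
          / (lamKP * θmin ^ 3 * nmin) := by
  set D : Matrix (Fin n) (Fin K) ℝ := diagonal θ * Z with hDdef
  set w : Fin K → ℝ := fun k => ∑ i with ℓ i = k, θ i ^ 2 with hwdef
  have hDapply : ∀ i k, D i k = if ℓ i = k then θ i else 0 := by
    intro i k
    simp [hDdef, diagonal_mul, hZ]
  have hDD : Dᵀ * D = diagonal w := by
    ext k l
    rw [mul_apply]
    simp only [transpose_apply, hDapply, diagonal_apply, hwdef]
    split_ifs with hkl
    · subst hkl
      rw [Finset.sum_filter]
      refine Finset.sum_congr rfl fun i _ => ?_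
      split_ifs <;> ring
    · refine Finset.sum_eq_zero fun i _ => ?_
      split_ifs with h1 h2
      · exact absurd (h1.symm.trans h2) hkl
      all_goals simp
  have hOmD : Om = D * P * Dᵀ := by
    rw [hOm, hDdef, transpose_mul, diagonal_transpose]
    simp only [Matrix.mul_assoc]
  have hθmin_le : ∀ i, θmin ≤ θ i := fun i => hθmin ▸ Finset.inf'_le _ (Finset.mem_univ i)
  have hle_θmax : ∀ i, θ i ≤ θmax := fun i => hθmax ▸ Finset.le_sup' _ (Finset.mem_univ i)
  have hθmin_pos : 0 < θmin := by
    rw [hθmin, Finset.lt_inf'_iff]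
    exact fun i _ => hθ i
  have hθmax_pos : 0 < θmax := (hθ 0).trans_le (hle_θmax 0)
  have hnmin_le : ∀ k, nmin ≤ (Finset.univ.filter fun i => ℓ i = k).card := fun k =>
    hnmin ▸ Finset.inf'_le (fun k => (Finset.univ.filter fun i => ℓ i = k).card)
      (Finset.mem_univ k)
  have hle_nmax : ∀ k, (Finset.univ.filter fun i => ℓ i = k).card ≤ nmax := fun k =>
    hnmax ▸ Finset.le_sup' (fun k => (Finset.univ.filter fun i => ℓ i = k).card)
      (Finset.mem_univ k)
  have hnmin_pos : 0 < nmin := by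
    rw [hnmin, Finset.lt_inf'_iff]
    intro k _
    obtain ⟨i, hi⟩ := hℓ k
    exact Finset.card_pos.mpr ⟨i, by simpa using hi⟩
  have hnmax_pos : 0 < nmax := hnmin_pos.trans_le ((hnmin_le 0).trans (hle_nmax 0))
  have hnminR : (0 : ℝ) < nmin := by exact_mod_cast hnmin_pos
  have hnmaxR : (0 : ℝ) < nmax := by exact_mod_cast hnmax_pos
  have hw_lower : ∀ k, θmin ^ 2 * nmin ≤ w k := by
    intro k
    calc θmin ^ 2 * nmin ≤ θmin ^ 2 * (Finset.univ.filter fun i => ℓ i = k).card := by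
          gcongr
          exact hnmin_le k
      _ = ∑ i with ℓ i = k, θmin ^ 2 := by simp [mul_comm]
      _ ≤ w k := Finset.sum_le_sum fun i _ => pow_le_pow_left₀ hθmin_pos.le (hθmin_le i) 2
  have hw_upper : ∀ k, w k ≤ θmax ^ 2 * nmax := by
    intro k
    calc w k ≤ ∑ i with ℓ i = k, θmax ^ 2 :=
          Finset.sum_le_sum fun i _ => pow_le_pow_left₀ (hθ i).le (hle_θmax i) 2
      _ = θmax ^ 2 * (Finset.univ.filter fun i => ℓ i = k).card := by simp [mul_comm]
      _ ≤ θmax ^ 2 * nmax := by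
          gcongr
          exact hle_nmax k
  have hlam_le : ∀ k, lamKP ≤ |hPH.eigenvalues k| := fun k =>
    hlamKP ▸ Finset.inf'_le (fun k => |hPH.eigenvalues k|) (Finset.mem_univ k)
  have hlam_pos : 0 < lamKP := by
    rw [hlamKP, Finset.lt_inf'_iff]
    intro k _
    refine abs_pos.mpr fun hk => ?_
    have hcard : Fintype.card {i // hPH.eigenvalues i ≠ 0} < Fintype.card (Fin K) :=
      Fintype.card_subtype_lt (x := k) (by simpa using hk)
    rw [← hPH.rank_eq_card_non_zero_eigs, hPrank, Fintype.card_fin] at hcard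
    exact lt_irrefl _ hcard
  have hsK_inv : sK⁻¹ ≤ (lamKP * (θmin ^ 2 * nmin))⁻¹ := by
    set S := {x : ℝ | ∃ i, hOmH.eigenvalues i ≠ 0 ∧ x = |hOmH.eigenvalues i|} with hS
    rcases S.eq_empty_or_nonempty with hempty | hne
    · rw [hsK, hempty, Real.sInf_empty, _root_.inv_zero]
      positivity
    · refine inv_anti₀ (by positivity) ?_
      rw [hsK]
      refine le_csInf hne ?_
      rintro x ⟨i, hi, rfl⟩
      refine mul_le_abs_of_mulVec_eq_smul hDD (by positivity) hw_lower hPH hlam_pos.le hlam_le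
        (v := hOmH.eigenvectorBasis i) ?_ hi ?_
      · intro h0
        exact hOmH.eigenvectorBasis.orthonormal.ne_zero i (by ext j; exact congrFun h0 j)
      · rw [← hOmD]
        exact hOmH.mulVec_eigenvectorBasis i
  have hUfac : U = D * (P * Dᵀ * U * diagonal fun k => (d k)⁻¹) := by
    have hΛinv : Λ * diagonal (fun k => (d k)⁻¹) = 1 := by
      rw [hΛ, diagonal_mul_diagonal, ← diagonal_one]
      congr 1
      ext k
      exact mul_inv_cancel₀ (hd k)
    calc U = U * Λ * (Uᵀ * U) * diagonal (fun k => (d k)⁻¹) := by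
          rw [hUU, Matrix.mul_one, Matrix.mul_assoc, hΛinv, Matrix.mul_one]
      _ = Om * U * diagonal (fun k => (d k)⁻¹) := by rw [hdec]; simp only [Matrix.mul_assoc]
      _ = _ := by rw [hOmD]; simp only [Matrix.mul_assoc]
  obtain ⟨B, hB⟩ : ∃ B : Matrix (Fin K) (Fin K) ℝ, U = D * B := ⟨_, hUfac⟩
  have hUi : ∀ i, U i = θ i • B (ℓ i) := by
    intro i
    ext k
    rw [hB, mul_apply]
    simp [hDapply]
  have hrow : ∀ i, 2 / rowNorm (U i) ≤ 2 * θmax * √nmax / θmin := by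
    intro i
    have hBw := rowNorm_sq_mul_eq_one hDD (hB ▸ hUU) (ℓ i)
    have hpos := rowNorm_pos (hUrow i)
    have hUB : rowNorm (U i) = θ i * rowNorm (B (ℓ i)) := by
      rw [hUi]
      simp [rowNorm_eq_norm_toLp, norm_smul, abs_of_pos (hθ i)]
    have hB1 : 1 ≤ rowNorm (B (ℓ i)) * (θmax * √nmax) := by
      refine (one_le_sq_iff₀ (mul_nonneg (rowNorm_nonneg _) (by positivity))).mp ?_
      rw [mul_pow, mul_pow, Real.sq_sqrt hnmaxR.le, ← hBw]
      exact mul_le_mul_of_nonneg_left (hw_upper _) (sq_nonneg _)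
    rw [div_le_div_iff₀ hpos hθmin_pos, hUB]
    have hmul := mul_le_mul (hθmin_le i) hB1 zero_le_one (hθ i).le
    linarith
  have hmain : frobNorm ((Matrix.of fun i k => Uh i k / rowNorm (Uh i)) * O
      - Matrix.of fun i k => U i k / rowNorm (U i))
      ≤ 2 * θmax * √nmax / θmin * frobNorm (Uh * O - U) := by
    refine frobNorm_le_mul_of_rowNorm_le (by positivity) fun i => ?_
    have hnorm := rowNorm_vecMul_of_orthogonal hO (Uh i)
    have hne : Uh i ᵥ* O ≠ 0 := by
      intro h0
      have hpos := rowNorm_pos (hUhrow i)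
      rw [← hnorm, h0] at hpos
      simp [rowNorm] at hpos
    have hlhs : ((Matrix.of fun i k => Uh i k / rowNorm (Uh i)) * O
        - Matrix.of fun i k => U i k / rowNorm (U i)) i
        = (rowNorm (Uh i ᵥ* O))⁻¹ • (Uh i ᵥ* O) - (rowNorm (U i))⁻¹ • U i := by
      ext k
      rw [hnorm]
      simp only [Matrix.sub_apply, mul_apply, of_apply, Pi.sub_apply, Pi.smul_apply, smul_eq_mul,
        vecMul, dotProduct, Finset.mul_sum, div_eq_inv_mul, mul_assoc]
    have hrhs : (Uh * O - U) i = Uh i ᵥ* O - U i := rfl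
    rw [hlhs, hrhs]
    exact (rowNorm_normalize_sub_le hne (hUrow i)).trans
      (mul_le_mul_of_nonneg_right (hrow i) (rowNorm_nonneg _))
  have hspec : 0 ≤ specNorm (A - Om) := norm_nonneg _
  calc _ ≤ 2 * θmax * √nmax / θmin * frobNorm (Uh * O - U) := hmain
    _ ≤ 2 * θmax * √nmax / θmin * (2 * √(2 * K) * specNorm (A - Om) * sK⁻¹) := by
        gcongr
        exact hbound
    _ ≤ 2 * θmax * √nmax / θmin
          * (2 * √(2 * K) * specNorm (A - Om) * (lamKP * (θmin ^ 2 * nmin))⁻¹) := by gcongr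
    _ = _ := by
        rw [Real.sqrt_mul (by positivity : (0 : ℝ) ≤ 2 * K)]
        field_simp
        ring
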